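/- Any three-qubit pure state can be written, up to local unitaries, in the canonical form λ₀|000⟩ + λ₁e^{iβ}|100⟩ + λ₂|101⟩ + λ₃|110⟩ + λ₄|111⟩ with λ_i ≥ 0, Σ λ_i² = 1, and β ∈ [0, π]. -/

import Mathlib

open Matrix Kronecker BigOperators

open scoped ComplexConjugate

namespace ThreeQubit

/-- The polarization of the determinant on `2 × 2` matrices. -/
def mixedDet (M N : Matrix (Fin 2) (Fin 2) ℂ) : ℂ := (M.adjugate * N).trace

lemma mixedDet_eq (M N : Matrix (Fin 2) (Fin 2) ℂ) :
    mixedDet M N = M 1 1 * N 0 0 - M 0 1 * N 1 0 - M 1 0 * N 0 1 + M 0 0 * N 1 1 := by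
  rw [mixedDet, adjugate_fin_two, trace_fin_two]
  simp only [Matrix.mul_apply, Fin.sum_univ_two, of_apply, cons_val', cons_val_zero, cons_val_one,
    cons_val_fin_one]
  ring

/-- The Hilbert–Schmidt inner product. -/
def hsInner (M N : Matrix (Fin 2) (Fin 2) ℂ) : ℂ := (Mᴴ * N).trace

/-- A function of a pencil of `2 × 2` matrices that is invariant under left and right unitaries and
whose sign decides the half-plane containing the phase of the canonical form. -/
def phaseInvariant (M N : Matrix (Fin 2) (Fin 2) ℂ) : ℝ :=
  (hsInner M N * mixedDet M N * conj N.det).im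

lemma conj_det_mul_det {V : Matrix (Fin 2) (Fin 2) ℂ}
    (hV : V ∈ unitaryGroup (Fin 2) ℂ) : conj V.det * V.det = 1 :=
  (Unitary.mem_iff.mp (det_of_mem_unitary hV)).1

lemma phaseInvariant_mul_left {V : Matrix (Fin 2) (Fin 2) ℂ}
    (hV : V ∈ unitaryGroup (Fin 2) ℂ) (M N : Matrix (Fin 2) (Fin 2) ℂ) :
    phaseInvariant (V * M) (V * N) = phaseInvariant M N := by
  have hd := conj_det_mul_det hV
  have hV' : Vᴴ * V = 1 := mem_unitaryGroup_iff'.mp hV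
  have hg : hsInner (V * M) (V * N) = hsInner M N := by
    unfold hsInner
    rw [conjTranspose_mul, Matrix.mul_assoc, ← Matrix.mul_assoc Vᴴ, hV', Matrix.one_mul]
  have hb : mixedDet (V * M) (V * N) = V.det * mixedDet M N := by
    unfold mixedDet
    rw [adjugate_mul_distrib, Matrix.mul_assoc, ← Matrix.mul_assoc V.adjugate, adjugate_mul]
    simp
  unfold phaseInvariant
  rw [hg, hb, det_mul, map_mul]
  congr 1
  linear_combination (hsInner M N * mixedDet M N * conj N.det) * hd

lemma phaseInvariant_mul_right {W : Matrix (Fin 2) (Fin 2) ℂ}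
    (hW : W ∈ unitaryGroup (Fin 2) ℂ) (M N : Matrix (Fin 2) (Fin 2) ℂ) :
    phaseInvariant (M * W) (N * W) = phaseInvariant M N := by
  have hd := conj_det_mul_det hW
  have hW' : W * Wᴴ = 1 := mem_unitaryGroup_iff.mp hW
  have hg : hsInner (M * W) (N * W) = hsInner M N := by
    unfold hsInner
    rw [conjTranspose_mul, Matrix.mul_assoc, trace_mul_comm, ← Matrix.mul_assoc, Matrix.mul_assoc,
      hW', Matrix.mul_one]
  have hb : mixedDet (M * W) (N * W) = W.det * mixedDet M N := by
    unfold mixedDet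
    rw [adjugate_mul_distrib, Matrix.mul_assoc, trace_mul_comm, ← Matrix.mul_assoc,
      Matrix.mul_assoc, mul_adjugate]
    simp
  unfold phaseInvariant
  rw [hg, hb, det_mul, map_mul]
  congr 1
  linear_combination (hsInner M N * mixedDet M N * conj N.det) * hd

lemma exists_unitary_row_zero {x y : ℂ} (h : x ≠ 0 ∨ y ≠ 0) :
    ∃ (c : ℝ) (U : Matrix (Fin 2) (Fin 2) ℂ), 0 < c ∧ U ∈ unitaryGroup (Fin 2) ℂ ∧
      U = (c : ℂ) • !![x, y; -conj y, conj x] := by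
  have hpos : 0 < Complex.normSq x + Complex.normSq y := by
    rcases h with h | h
    · have := Complex.normSq_pos.mpr h
      have := Complex.normSq_nonneg y
      linarith
    · have := Complex.normSq_pos.mpr h
      have := Complex.normSq_nonneg x
      linarith
  set n := Complex.normSq x + Complex.normSq y with hn
  refine ⟨(√n)⁻¹, _, by positivity, ?_, rfl⟩
  have hc : (((√n)⁻¹ : ℝ) : ℂ) * (((√n)⁻¹ : ℝ) : ℂ) * (x * conj x + y * conj y) = 1 := by
    rw [Complex.mul_conj, Complex.mul_conj, ← Complex.ofReal_add, ← hn, ← Complex.ofReal_mul,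
      ← Complex.ofReal_mul, ← mul_inv, Real.mul_self_sqrt hpos.le, inv_mul_cancel₀ hpos.ne',
      Complex.ofReal_one]
  rw [mem_unitaryGroup_iff]
  generalize (√n)⁻¹ = c at hc
  ext i j
  fin_cases i <;> fin_cases j <;>
    simp [Matrix.mul_apply, Fin.sum_univ_two, star_eq_conjTranspose]
  · linear_combination hc
  · ring
  · ring
  · linear_combination hc

/-- A nonzero row can be annihilated by the second row of a unitary. -/
lemma exists_unitary_row_one (a b : ℂ) :
    ∃ U ∈ unitaryGroup (Fin 2) ℂ, U 1 0 * a + U 1 1 * b = 0 := by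
  by_cases h : a = 0 ∧ b = 0
  · exact ⟨1, one_mem _, by simp [h]⟩
  · obtain ⟨c, U, -, hU, rfl⟩ := exists_unitary_row_zero (x := conj a) (y := conj b)
      (by simpa [← not_and_or] using h)
    exact ⟨_, hU, by simp; ring⟩

/-- The two matrix slices after a unitary on the first qubit. -/
def slice (U : Matrix (Fin 2) (Fin 2) ℂ) (M N : Matrix (Fin 2) (Fin 2) ℂ) (i : Fin 2) :
    Matrix (Fin 2) (Fin 2) ℂ := U i 0 • M + U i 1 • N

lemma slice_mul (U U' M N : Matrix (Fin 2) (Fin 2) ℂ) (i : Fin 2) :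
    slice (U * U') M N i = slice U (slice U' M N 0) (slice U' M N 1) i := by
  simp only [slice, Matrix.mul_apply, Fin.sum_univ_two]
  module

lemma det_smul_add_smul (M N : Matrix (Fin 2) (Fin 2) ℂ) (x y : ℂ) :
    (x • M + y • N).det = x ^ 2 * M.det + x * y * mixedDet M N + y ^ 2 * N.det := by
  simp [mixedDet_eq, det_fin_two]
  ring

lemma exists_unitary_det_slice_zero (M N : Matrix (Fin 2) (Fin 2) ℂ) :
    ∃ U ∈ unitaryGroup (Fin 2) ℂ, (slice U M N 0).det = 0 := by
  by_cases hM : M.det = 0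
  · exact ⟨1, one_mem _, by simpa [slice] using hM⟩
  obtain ⟨s, hs⟩ := IsAlgClosed.exists_pow_nat_eq (discrim M.det (mixedDet M N) N.det)
    (n := 2) (by norm_num)
  obtain ⟨x, hx⟩ := exists_quadratic_eq_zero hM ⟨s, by rw [← hs, sq]⟩
  obtain ⟨c, U, -, hU, rfl⟩ := exists_unitary_row_zero (x := x) (y := 1) (by simp)
  refine ⟨_, hU, ?_⟩
  rw [slice, det_smul_add_smul]
  simp
  linear_combination (c : ℂ) ^ 2 * hx

lemma mixedDet_smul_add_smul (M N : Matrix (Fin 2) (Fin 2) ℂ) (x y z w : ℂ) :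
    mixedDet (x • M + y • N) (z • M + w • N) =
      2 * x * z * M.det + (x * w + y * z) * mixedDet M N + 2 * y * w * N.det := by
  simp [mixedDet_eq, det_fin_two]
  ring

lemma conj_hsInner (M N : Matrix (Fin 2) (Fin 2) ℂ) : conj (hsInner M N) = hsInner N M := by
  simp [hsInner, trace_fin_two, Matrix.mul_apply, Fin.sum_univ_two]
  ring

lemma hsInner_smul_add_smul (M N : Matrix (Fin 2) (Fin 2) ℂ) (x y z w : ℂ) :
    hsInner (x • M + y • N) (z • M + w • N) =
      conj x * z * hsInner M M + conj x * w * hsInner M N +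
        conj y * z * hsInner N M + conj y * w * hsInner N N := by
  simp [hsInner, trace_fin_two, Matrix.mul_apply, Fin.sum_univ_two]
  ring

lemma hsInner_self_im (M : Matrix (Fin 2) (Fin 2) ℂ) : (hsInner M M).im = 0 :=
  Complex.conj_eq_iff_im.mp (conj_hsInner M M)

/-- The second zero of the determinant on the pencil has the opposite sign of the invariant. -/
lemma exists_unitary_phaseInvariant_nonpos {M N : Matrix (Fin 2) (Fin 2) ℂ} (hM : M.det = 0) :
    ∃ U ∈ unitaryGroup (Fin 2) ℂ, (slice U M N 0).det = 0 ∧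
      phaseInvariant (slice U M N 0) (slice U M N 1) ≤ 0 := by
  by_cases hS : phaseInvariant M N ≤ 0
  · exact ⟨1, one_mem _, by simpa [slice] using hM, by simpa [slice] using hS⟩
  have hD : N.det ≠ 0 := by
    intro h
    simp [phaseInvariant, h] at hS
  obtain ⟨c, U, hc, hU, rfl⟩ := exists_unitary_row_zero (x := -N.det) (y := mixedDet M N)
    (Or.inl (neg_ne_zero.mpr hD))
  refine ⟨_, hU, ?_, ?_⟩
  · rw [slice, det_smul_add_smul, hM]
    simp
    ring
  · have key : ∀ (c : ℝ) (g h k μ Δ : ℂ), g.im = 0 → h.im = 0 →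
        ((conj (c * -Δ) * (c * -conj μ) * g + conj (c * -Δ) * (c * -conj Δ) * k +
          conj (c * μ) * (c * -conj μ) * conj k + conj (c * μ) * (c * -conj Δ) * h) *
          (2 * (c * -Δ) * (c * -conj μ) * 0 +
            ((c * -Δ) * (c * -conj Δ) + (c * μ) * (c * -conj μ)) * μ +
            2 * (c * μ) * (c * -conj Δ) * Δ) *
          conj ((c * -conj μ) ^ 2 * 0 + (c * -conj μ) * (c * -conj Δ) * μ +
            (c * -conj Δ) ^ 2 * Δ)).im =
        -(c ^ 6 * (Complex.normSq Δ + Complex.normSq μ) ^ 3 * (k * μ * conj Δ).im) := by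
      intro c g h k μ Δ hg hh
      simp [Complex.normSq_apply, pow_two, hg, hh]
      ring
    unfold phaseInvariant at hS ⊢
    simp only [slice, det_smul_add_smul, mixedDet_smul_add_smul, hsInner_smul_add_smul, hM]
    rw [← conj_hsInner M N]
    simp only [Matrix.smul_apply, of_apply, cons_val', cons_val_zero, cons_val_one, cons_val_fin_one,
      smul_eq_mul, map_neg]
    have := key c _ _ (hsInner M N) (mixedDet M N) N.det (hsInner_self_im M) (hsInner_self_im N)
    simp only [map_neg, map_mul] at this ⊢
    rw [this]
    have := Complex.normSq_nonneg N.det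
    have := Complex.normSq_nonneg (mixedDet M N)
    push Not at hS
    simp only [neg_nonpos]
    positivity

/-- A singular `2 × 2` matrix is supported on its `(0, 0)` entry in suitable orthonormal bases; if
it vanishes, the bases can be used to annihilate an entry of a second matrix. -/
lemma exists_unitary_corner {M : Matrix (Fin 2) (Fin 2) ℂ} (hM : M.det = 0)
    (N : Matrix (Fin 2) (Fin 2) ℂ) :
    ∃ V ∈ unitaryGroup (Fin 2) ℂ, ∃ W ∈ unitaryGroup (Fin 2) ℂ, ∃ a : ℂ,
      V * M * Wᵀ = !![a, 0; 0, 0] ∧ (a = 0 → (V * N * Wᵀ) 0 1 = 0) := by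
  by_cases h0 : M = 0
  · obtain ⟨W, hW, h⟩ := exists_unitary_row_one (N 0 0) (N 0 1)
    refine ⟨1, one_mem _, W, hW, 0, ?_, fun _ => ?_⟩
    · ext i j
      fin_cases i <;> fin_cases j <;> simp [h0]
    · simp [Matrix.mul_apply, Fin.sum_univ_two]
      linear_combination h
  obtain ⟨p, hp0, hp⟩ := exists_vecMul_eq_zero_iff.mpr hM
  obtain ⟨q, hq0, hq⟩ := exists_mulVec_eq_zero_iff.mpr hM
  have unit_row : ∀ p : Fin 2 → ℂ, p ≠ 0 → ∃ c : ℂ, ∃ U ∈ unitaryGroup (Fin 2) ℂ,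
      U 1 0 = c * p 0 ∧ U 1 1 = c * p 1 := by
    intro p hp
    obtain ⟨c, U, -, hU, rfl⟩ := exists_unitary_row_zero (x := conj (p 1)) (y := -conj (p 0)) (by
      by_contra! h
      apply hp
      ext i
      fin_cases i <;> simp_all)
    exact ⟨c, _, hU, by simp, by simp⟩
  obtain ⟨c, V, hV, hV0, hV1⟩ := unit_row p hp0
  obtain ⟨d, W, hW, hW0, hW1⟩ := unit_row q hq0
  have e : V * M * Wᵀ = !![(V * M * Wᵀ) 0 0, 0; 0, 0] := by
    have p0 := congrFun hp 0
    have p1 := congrFun hp 1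
    have q0 := congrFun hq 0
    have q1 := congrFun hq 1
    simp [vecMul, mulVec, dotProduct, Fin.sum_univ_two] at p0 p1 q0 q1
    ext i j
    fin_cases i <;> fin_cases j <;>
      simp [Matrix.mul_apply, Fin.sum_univ_two, hV0, hV1, hW0, hW1]
    · linear_combination d * V 0 0 * q0 + d * V 0 1 * q1
    · linear_combination c * W 0 0 * p0 + c * W 0 1 * p1
    · linear_combination c * d * q 0 * p0 + c * d * q 1 * p1
  refine ⟨V, hV, W, hW, _, e, fun h => absurd ?_ h0⟩
  have z : V * M * Wᵀ = 0 := by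
    rw [e, h]
    ext i j
    fin_cases i <;> fin_cases j <;> rfl
  have hV' : Vᴴ * V = 1 := mem_unitaryGroup_iff'.mp hV
  have hW' : Wᵀ * Wᴴᵀ = 1 := by
    rw [← transpose_mul, ← star_eq_conjTranspose, mem_unitaryGroup_iff'.mp hW, transpose_one]
  calc M = (Vᴴ * V) * M * (Wᵀ * Wᴴᵀ) := by rw [hV', hW', Matrix.one_mul, Matrix.mul_one]
    _ = Vᴴ * (V * M * Wᵀ) * Wᴴᵀ := by simp only [Matrix.mul_assoc]
    _ = 0 := by rw [z]; simp

lemma exists_phase (z : ℂ) : ∃ e : ℂ, conj e * e = 1 ∧ e * z = ‖z‖ := by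
  by_cases hz : z = 0
  · exact ⟨1, by simp [hz]⟩
  have hn : (‖z‖ : ℂ) ≠ 0 := by simpa using hz
  have hm : z * conj z = ‖z‖ ^ 2 := Complex.mul_conj' z
  refine ⟨conj z / ‖z‖, ?_, ?_⟩
  · simp only [map_div₀, Complex.conj_conj, Complex.conj_ofReal]
    field_simp
    linear_combination hm
  · field_simp
    linear_combination hm

/-- Phases making three of the entries of a `2 × 2` matrix nonnegative. -/
lemma exists_phases (z z₂ z₃ z₄ : ℂ)
    (h : z₂ = 0 ∨ z₃ = 0 ∨ z₄ = 0 ∨ 0 ≤ (z * z₄ * conj (z₂ * z₃)).im) :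
    ∃ e₁ e₂ e₃ e₄ : ℂ, conj e₁ * e₁ = 1 ∧ conj e₂ * e₂ = 1 ∧ conj e₃ * e₃ = 1 ∧
      e₁ * e₄ = e₂ * e₃ ∧ 0 ≤ (e₁ * z).im ∧
      e₂ * z₂ = ‖z₂‖ ∧ e₃ * z₃ = ‖z₃‖ ∧ e₄ * z₄ = ‖z₄‖ := by
  obtain ⟨e₁, h₁, k₁⟩ := exists_phase z
  obtain ⟨e₂, h₂, k₂⟩ := exists_phase z₂
  obtain ⟨e₃, h₃, k₃⟩ := exists_phase z₃
  obtain ⟨e₄, h₄, k₄⟩ := exists_phase z₄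
  have hi : 0 ≤ (e₁ * z).im := by simp [k₁]
  by_cases n₂ : z₂ = 0
  · refine ⟨e₁, e₁ * e₄ * conj e₃, e₃, e₄, h₁, ?_, h₃, ?_, hi, by simp [n₂], k₃, k₄⟩
    · simp only [map_mul, Complex.conj_conj]
      linear_combination conj e₄ * e₄ * conj e₃ * e₃ * h₁ + conj e₃ * e₃ * h₄ + h₃
    · linear_combination -e₁ * e₄ * h₃
  by_cases n₃ : z₃ = 0
  · refine ⟨e₁, e₂, e₁ * e₄ * conj e₂, e₄, h₁, h₂, ?_, ?_, hi, k₂, by simp [n₃], k₄⟩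
    · simp only [map_mul, Complex.conj_conj]
      linear_combination conj e₄ * e₄ * conj e₂ * e₂ * h₁ + conj e₂ * e₂ * h₄ + h₂
    · linear_combination -e₁ * e₄ * h₂
  by_cases n₄ : z₄ = 0
  · refine ⟨e₁, e₂, e₃, conj e₁ * e₂ * e₃, h₁, h₂, h₃, ?_, hi, k₂, k₃, by simp [n₄]⟩
    linear_combination e₂ * e₃ * h₁
  replace h : 0 ≤ (z * z₄ * conj (z₂ * z₃)).im := by tauto
  refine ⟨e₂ * e₃ * conj e₄, e₂, e₃, e₄, ?_, h₂, h₃, ?_, ?_, k₂, k₃, k₄⟩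
  · simp only [map_mul, Complex.conj_conj]
    linear_combination conj e₃ * e₃ * conj e₄ * e₄ * h₂ + conj e₄ * e₄ * h₃ + h₄
  · linear_combination e₂ * e₃ * h₄
  · have inv : ∀ {e w : ℂ}, conj e * e = 1 → e * w = ‖w‖ → w = conj e * ‖w‖ := by
      intro e w he hw
      linear_combination -w * he + conj e * hw
    have m₂ := congrArg conj (inv h₂ k₂)
    have m₃ := congrArg conj (inv h₃ k₃)
    have m₄ := inv h₄ k₄
    simp only [map_mul, Complex.conj_conj, Complex.conj_ofReal] at m₂ m₃
    have key : z * z₄ * conj (z₂ * z₃) =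
        ((‖z₂‖ * ‖z₃‖ * ‖z₄‖ : ℝ) : ℂ) * (e₂ * e₃ * conj e₄ * z) := by
      rw [map_mul, m₂, m₃]
      nth_rewrite 1 [m₄]
      push_cast
      ring
    rw [key, Complex.im_ofReal_mul] at h
    exact nonneg_of_mul_nonneg_right h (by positivity)

lemma diagonal_mem_unitaryGroup {a b : ℂ} (ha : conj a * a = 1) (hb : conj b * b = 1) :
    !![a, 0; 0, b] ∈ unitaryGroup (Fin 2) ℂ := by
  rw [mem_unitaryGroup_iff']
  ext i j
  fin_cases i <;> fin_cases j <;>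
    simp [Matrix.mul_apply, Fin.sum_univ_two, star_eq_conjTranspose, ha, hb]

lemma diagonal_mul_mul_diagonal (s t : ℂ) (B : Matrix (Fin 2) (Fin 2) ℂ) :
    !![1, 0; 0, s] * B * !![1, 0; 0, t]ᵀ = !![B 0 0, t * B 0 1; s * B 1 0, s * t * B 1 1] := by
  ext i j
  fin_cases i <;> fin_cases j <;>
    simp [Matrix.mul_apply, vecMul, dotProduct, Fin.sum_univ_two] <;>
    ring

/-- The canonical form of a pencil of `2 × 2` matrices. -/
lemma exists_canonical_slices (M N : Matrix (Fin 2) (Fin 2) ℂ) :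
    ∃ U ∈ unitaryGroup (Fin 2) ℂ, ∃ V ∈ unitaryGroup (Fin 2) ℂ, ∃ W ∈ unitaryGroup (Fin 2) ℂ,
      ∃ (l₀ l₂ l₃ l₄ : ℝ) (z : ℂ), 0 ≤ l₀ ∧ 0 ≤ l₂ ∧ 0 ≤ l₃ ∧ 0 ≤ l₄ ∧ 0 ≤ z.im ∧
        V * slice U M N 0 * Wᵀ = !![(l₀ : ℂ), 0; 0, 0] ∧
        V * slice U M N 1 * Wᵀ = !![z, (l₂ : ℂ); (l₃ : ℂ), (l₄ : ℂ)] := by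
  obtain ⟨U₁, hU₁, hdet₁⟩ := exists_unitary_det_slice_zero M N
  obtain ⟨U₂, hU₂, hdet, hS⟩ :=
    exists_unitary_phaseInvariant_nonpos (N := slice U₁ M N 1) hdet₁
  rw [← slice_mul] at hdet hS
  rw [← slice_mul] at hS
  set U := U₂ * U₁
  obtain ⟨V, hV, W, hW, a, hA, ha⟩ := exists_unitary_corner hdet (slice U M N 1)
  have hWt : Wᵀ ∈ unitaryGroup (Fin 2) ℂ := transpose_mem_unitaryGroup_iff.mpr hW
  rw [← phaseInvariant_mul_left hV, ← phaseInvariant_mul_right hWt, hA] at hS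
  generalize hB : V * slice U M N 1 * Wᵀ = B at hS ha
  have hphase : B 0 1 = 0 ∨ B 1 0 = 0 ∨ B 1 1 = 0 ∨
      0 ≤ (B 0 0 * B 1 1 * conj (B 0 1 * B 1 0)).im := by
    by_cases ha0 : a = 0
    · exact Or.inl (ha ha0)
    · refine Or.inr (Or.inr (Or.inr ?_))
      have e : phaseInvariant !![a, 0; 0, 0] B =
          -(Complex.normSq a * (B 0 0 * B 1 1 * conj (B 0 1 * B 1 0)).im) := by
        simp [phaseInvariant, hsInner, mixedDet_eq, det_fin_two, trace_fin_two,
          Matrix.mul_apply, Fin.sum_univ_two, Complex.normSq_apply]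
        ring
      rw [e, neg_nonpos] at hS
      exact nonneg_of_mul_nonneg_right hS (Complex.normSq_pos.mpr ha0)
  obtain ⟨e₀, h₀, k₀⟩ := exists_phase a
  obtain ⟨e₁, e₂, e₃, e₄, h₁, h₂, h₃, h₄, hi, k₂, k₃, k₄⟩ := exists_phases _ _ _ _ hphase
  have hu : ∀ {e : ℂ}, conj e * e = 1 → conj (e * conj e₁) * (e * conj e₁) = 1 := by
    intro e he
    simp only [map_mul, Complex.conj_conj]
    linear_combination conj e * e * h₁ + he
  have h1 : conj (1 : ℂ) * 1 = 1 := by simp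
  have assoc : ∀ (X Y A Z T : Matrix (Fin 2) (Fin 2) ℂ) (c : ℂ),
      X * Y * (c • A) * (Z * T)ᵀ = c • (X * (Y * A * Tᵀ) * Zᵀ) := by
    intro X Y A Z T c
    simp only [transpose_mul, Matrix.mul_assoc, Matrix.mul_smul, Matrix.smul_mul]
  have s0 : slice (!![e₀, 0; 0, e₁] * U) M N 0 = e₀ • slice U M N 0 := by
    rw [slice_mul]
    simp [slice]
  have s1 : slice (!![e₀, 0; 0, e₁] * U) M N 1 = e₁ • slice U M N 1 := by
    rw [slice_mul]
    simp [slice]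
  refine ⟨!![e₀, 0; 0, e₁] * U,
    mul_mem (diagonal_mem_unitaryGroup h₀ h₁) (mul_mem hU₂ hU₁),
    !![1, 0; 0, e₃ * conj e₁] * V, mul_mem (diagonal_mem_unitaryGroup h1 (hu h₃)) hV,
    !![1, 0; 0, e₂ * conj e₁] * W, mul_mem (diagonal_mem_unitaryGroup h1 (hu h₂)) hW,
    ‖a‖, ‖B 0 1‖, ‖B 1 0‖, ‖B 1 1‖, e₁ * B 0 0, norm_nonneg _, norm_nonneg _, norm_nonneg _,
    norm_nonneg _, hi, ?_, ?_⟩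
  · rw [s0, assoc, hA, ← k₀, diagonal_mul_mul_diagonal]
    simp
  · rw [s1, assoc, hB, ← k₂, ← k₃, ← k₄, diagonal_mul_mul_diagonal]
    ext i j
    fin_cases i <;> fin_cases j <;> simp
    · linear_combination e₂ * B 0 1 * h₁
    · linear_combination e₃ * B 1 0 * h₁
    · linear_combination
        B 1 1 * (e₂ * e₃ * conj e₁ * h₁ - conj e₁ * h₄ + e₄ * h₁)

lemma kronecker_mulVec_apply (U V W : Matrix (Fin 2) (Fin 2) ℂ) (v : Fin 2 × Fin 2 × Fin 2 → ℂ)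
    (i j k : Fin 2) :
    (U ⊗ₖ (V ⊗ₖ W)).mulVec v (i, j, k) =
      (V * slice U (of fun j k => v (0, j, k)) (of fun j k => v (1, j, k)) i * Wᵀ) j k := by
  simp [mulVec, dotProduct, Fintype.sum_prod_type, Fin.sum_univ_two, kroneckerMap_apply, slice,
    Matrix.mul_apply]
  ring

lemma star_dotProduct_mulVec_of_mem_unitaryGroup {n : Type*} [Fintype n] [DecidableEq n]
    {U : Matrix n n ℂ} (hU : U ∈ unitaryGroup n ℂ) (v : n → ℂ) :
    star (U.mulVec v) ⬝ᵥ U.mulVec v = star v ⬝ᵥ v := by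
  rw [star_mulVec, ← dotProduct_mulVec, mulVec_mulVec, ← star_eq_conjTranspose,
    mem_unitaryGroup_iff'.mp hU, one_mulVec]

end ThreeQubit

open ThreeQubit in

/-- generalized Schmidt (Acín) decomposition — any three-qubit pure
state can be brought, by local unitaries, to the canonical form
λ₀|000⟩ + λ₁e^{iβ}|100⟩ + λ₂|101⟩ + λ₃|110⟩ + λ₄|111⟩ with λᵢ ≥ 0, Σλᵢ² = 1,
β ∈ [0, π]. -/
theorem acin_canonical_form (v : Fin 2 × Fin 2 × Fin 2 → ℂ)
    (hv : star v ⬝ᵥ v = 1) :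
    ∃ (U V W : Matrix (Fin 2) (Fin 2) ℂ),
      U ∈ Matrix.unitaryGroup (Fin 2) ℂ ∧
      V ∈ Matrix.unitaryGroup (Fin 2) ℂ ∧
      W ∈ Matrix.unitaryGroup (Fin 2) ℂ ∧
      ∃ (l : Fin 5 → ℝ) (β : ℝ),
        (∀ i, 0 ≤ l i) ∧ (∑ i, l i ^ 2 = 1) ∧ 0 ≤ β ∧ β ≤ Real.pi ∧
        (U ⊗ₖ (V ⊗ₖ W)).mulVec v = fun x =>
          if x = (0, 0, 0) then (l 0 : ℂ)
          else if x = (1, 0, 0) then (l 1 : ℂ) * Complex.exp (Complex.I * β)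
          else if x = (1, 0, 1) then (l 2 : ℂ)
          else if x = (1, 1, 0) then (l 3 : ℂ)
          else if x = (1, 1, 1) then (l 4 : ℂ)
          else 0 := by
  obtain ⟨U, hU, V, hV, W, hW, l₀, l₂, l₃, l₄, z, h₀, h₂, h₃, h₄, hz, e₀, e₁⟩ :=
    exists_canonical_slices (of fun j k => v (0, j, k)) (of fun j k => v (1, j, k))
  have hform : (U ⊗ₖ (V ⊗ₖ W)).mulVec v = fun x =>
      if x = (0, 0, 0) then (l₀ : ℂ) else if x = (1, 0, 0) then z
      else if x = (1, 0, 1) then (l₂ : ℂ) else if x = (1, 1, 0) then (l₃ : ℂ)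
      else if x = (1, 1, 1) then (l₄ : ℂ) else 0 := by
    ext ⟨i, j, k⟩
    rw [kronecker_mulVec_apply]
    fin_cases i
    · simp only [Fin.zero_eta, e₀]
      fin_cases j <;> fin_cases k <;> simp
    · simp only [Fin.mk_one, e₁]
      fin_cases j <;> fin_cases k <;> simp
  have hpolar : (‖z‖ : ℂ) * Complex.exp (Complex.I * z.arg) = z := by
    rw [mul_comm Complex.I, Complex.norm_mul_exp_arg_mul_I]
  refine ⟨U, V, W, hU, hV, hW, ![l₀, ‖z‖, l₂, l₃, l₄], z.arg, ?_, ?_,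
    Complex.arg_nonneg_iff.mpr hz, Complex.arg_le_pi z, ?_⟩
  · intro i
    fin_cases i <;> simp [*]
  · have hn := star_dotProduct_mulVec_of_mem_unitaryGroup
      (kronecker_mem_unitary hU (kronecker_mem_unitary hV hW)) v
    rw [hv, hform] at hn
    simp [dotProduct, Fintype.sum_prod_type, Fin.sum_univ_two] at hn
    rw [← Complex.normSq_eq_conj_mul_self, Complex.normSq_eq_norm_sq] at hn
    norm_cast at hn
    simp [Fin.sum_univ_five]
    linarith
  · rw [hform]
    simp only [cons_val, hpolar]
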